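/- arXiv:2203.12864 — 9 statements merged into one kernel-verified Lean document; each statement's English description precedes it below -/
import Mathlib

section
/- Let ν be a probability measure on a measurable space X, let V : X → ℝ be a bounded measurable function, and set Z := ∫ exp(−V) dν (which satisfies 0 < Z < ∞). Let ν* be the probability measure with density exp(−V)/Z with respect to ν. Then for every probability measure μ on X with μ ≪ ν and KL(μ‖ν) < ∞, one has KL(μ‖ν) + ∫ V dμ = KL(μ‖ν*) − log Z. -/
open MeasureTheory

/- Kullback–Leibler divergence: `∫ log (dμ/dν) dμ` if `μ ≪ ν` and this integral is
defined, and `+∞` otherwise. -/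
open Classical in
noncomputable def klDiv {X : Type*} [MeasurableSpace X] (μ ν : Measure X) : EReal :=
  if μ ≪ ν ∧ Integrable (llr μ ν) μ then ((∫ x, llr μ ν x ∂μ : ℝ) : EReal) else ⊤

theorem stmt_0 {X : Type*} [MeasurableSpace X] (ν : Measure X) [IsProbabilityMeasure ν]
    (V : X → ℝ) (hVmeas : Measurable V) (hVbdd : ∃ C : ℝ, ∀ x, |V x| ≤ C)
    (Z : ℝ) (hZ : Z = ∫ x, Real.exp (-V x) ∂ν)
    (νstar : Measure X)
    (hνstar : νstar = ν.withDensity (fun x => ENNReal.ofReal (Real.exp (-V x) / Z))) :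
    0 < Z ∧
      ∀ μ : Measure X, IsProbabilityMeasure μ → μ ≪ ν → klDiv μ ν < ⊤ →
        klDiv μ ν + ((∫ x, V x ∂μ : ℝ) : EReal) =
          klDiv μ νstar - ((Real.log Z : ℝ) : EReal) := by
  obtain ⟨C, hC⟩ := hVbdd
  have hint : ∀ (m : Measure X), IsProbabilityMeasure m → Integrable (fun x => -V x) m := by
    intro m hm
    refine Integrable.of_bound hVmeas.neg.aestronglyMeasurable C (ae_of_all _ fun x => ?_)
    simpa using hC x
  have hexp : Integrable (fun x => Real.exp (-V x)) ν := by
    refine Integrable.of_bound hVmeas.neg.exp.aestronglyMeasurable (Real.exp C)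
      (ae_of_all _ fun x => ?_)
    rw [Real.norm_eq_abs, abs_of_pos (Real.exp_pos _), Real.exp_le_exp]
    have := neg_abs_le (V x)
    linarith [hC x]
  have hZpos : 0 < Z := by
    rw [hZ]
    exact integral_exp_pos hexp
  refine ⟨hZpos, fun μ hμ hac hkl => ?_⟩
  have hst : νstar = ν.tilted (fun x => -V x) := by
    rw [hνstar, hZ]
    rfl
  have hI : Integrable (llr μ ν) μ := by
    by_contra h
    simp [klDiv, h] at hkl
  have hI' : Integrable (llr μ νstar) μ := by
    rw [hst]
    exact integrable_llr_tilted_right hac (hint μ hμ) hI hexp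
  have hac' : μ ≪ νstar := by
    rw [hst]
    exact hac.trans (absolutelyContinuous_tilted hexp)
  have key := integral_llr_tilted_right hac (hint μ hμ) hexp hI
  rw [← hst, ← hZ, integral_neg] at key
  rw [klDiv, klDiv, if_pos ⟨hac, hI⟩, if_pos ⟨hac', hI'⟩, ← EReal.coe_add, ← EReal.coe_sub, key]
  congr 1
  ring
end

section
/- Let ν be a probability measure on a measurable space X, let V : X → ℝ be a bounded measurable function, and set Z := ∫ exp(−V) dν. Then the infimum over all probability measures μ on X of KL(μ‖ν) + ∫ V dμ equals −log Z, and this infimum is attained by the probability measure ν* whose density with respect to ν is exp(−V)/Z. -/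
open MeasureTheory

theorem stmt_1 {X : Type*} [MeasurableSpace X] (ν : Measure X) [IsProbabilityMeasure ν]
    (V : X → ℝ) (hVmeas : Measurable V) (hVbdd : ∃ C : ℝ, ∀ x, |V x| ≤ C)
    (Z : ℝ) (hZ : Z = ∫ x, Real.exp (-V x) ∂ν)
    (νstar : Measure X)
    (hνstar : νstar = ν.withDensity (fun x => ENNReal.ofReal (Real.exp (-V x) / Z))) :
    IsLeast {r : EReal | ∃ μ : Measure X, IsProbabilityMeasure μ ∧
        r = klDiv μ ν + ((∫ x, V x ∂μ : ℝ) : EReal)}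
      ((-Real.log Z : ℝ) : EReal) ∧
    IsProbabilityMeasure νstar ∧
    klDiv νstar ν + ((∫ x, V x ∂νstar : ℝ) : EReal) = ((-Real.log Z : ℝ) : EReal) := by
  obtain ⟨C, hC⟩ := hVbdd
  have hexp : Integrable (fun x => Real.exp ((fun y => -V y) x)) ν := by
    refine Integrable.of_bound (by fun_prop) (Real.exp C) (ae_of_all _ fun x => ?_)
    rw [Real.norm_eq_abs, Real.abs_exp]
    exact Real.exp_le_exp.2 (by have := neg_abs_le (V x); have := hC x; linarith)
  have hst : νstar = ν.tilted (fun y => -V y) := by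
    rw [hνstar, hZ]; rfl
  have hVint : ∀ μ : Measure X, IsProbabilityMeasure μ → Integrable V μ := fun μ _ =>
    Integrable.of_bound (by fun_prop) C (ae_of_all _ hC)
  have hprob : IsProbabilityMeasure νstar := by
    rw [hst]; exact isProbabilityMeasure_tilted hexp
  have hac : νstar ≪ ν := by rw [hst]; exact tilted_absolutelyContinuous _ _
  have hllr : llr νstar ν =ᵐ[νstar] fun x => -V x - Real.log Z := by
    apply hac.ae_le
    rw [hst, hZ]
    exact log_rnDeriv_tilted_left_self hexp
  have hint : Integrable (llr νstar ν) νstar :=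
    (((hVint νstar hprob).neg).sub (integrable_const _)).congr hllr.symm
  have hval : klDiv νstar ν + ((∫ x, V x ∂νstar : ℝ) : EReal) = ((-Real.log Z : ℝ) : EReal) := by
    rw [klDiv, if_pos ⟨hac, hint⟩, ← EReal.coe_add, integral_congr_ae hllr,
      integral_sub (f := fun x => -V x) (hVint νstar hprob).neg (integrable_const _), integral_neg]
    congr 1
    simp only [integral_const, probReal_univ, one_smul]
    ring
  refine ⟨⟨⟨νstar, hprob, hval.symm⟩, ?_⟩, hprob, hval⟩
  rintro r ⟨μ, hμ, rfl⟩
  by_cases h : μ ≪ ν ∧ Integrable (llr μ ν) μ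
  · rw [klDiv, if_pos h, ← EReal.coe_add, EReal.coe_le_coe_iff]
    have hpt : IsProbabilityMeasure (ν.tilted (fun y => -V y)) := isProbabilityMeasure_tilted hexp
    have h1 := integral_llr_tilted_right h.1 (hVint μ hμ).neg hexp h.2
    have h2 := InformationTheory.integral_llr_add_sub_measure_univ_nonneg
      (h.1.trans (absolutelyContinuous_tilted hexp))
      (integrable_llr_tilted_right h.1 (hVint μ hμ).neg h.2 hexp)
    simp only [probReal_univ, Pi.neg_apply, integral_neg] at h1 h2
    have h3 : (∫ x, llr μ (ν.tilted (fun y => -V y)) x ∂μ)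
      = ∫ x, llr μ ν x ∂μ - (-∫ x, V x ∂μ) + Real.log (∫ x, Real.exp (-V x) ∂ν) := h1
    have h4 : 0 ≤ (∫ x, llr μ (ν.tilted (fun y => -V y)) x ∂μ) + 1 - 1 := h2
    rw [hZ]
    linarith
  · rw [klDiv, if_neg h, EReal.top_add_coe]
    exact le_top
end

section
/- Let ν be a probability measure on a measurable space X, let V : X → ℝ be a bounded measurable function, set Z := ∫ exp(−V) dν, and let ν* be the probability measure with density exp(−V)/Z with respect to ν. If a probability measure μ on X satisfies KL(μ‖ν) + ∫ V dμ = −log Z, then μ = ν*. In other words, ν* is the unique minimizer of μ ↦ KL(μ‖ν) + ∫ V dμ over probability measures. -/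
open MeasureTheory

theorem stmt_2 {X : Type*} [MeasurableSpace X] (ν : Measure X) [IsProbabilityMeasure ν]
    (V : X → ℝ) (hVmeas : Measurable V) (hVbdd : ∃ C : ℝ, ∀ x, |V x| ≤ C)
    (Z : ℝ) (hZ : Z = ∫ x, Real.exp (-V x) ∂ν)
    (νstar : Measure X)
    (hνstar : νstar = ν.withDensity (fun x => ENNReal.ofReal (Real.exp (-V x) / Z))) :
    ∀ μ : Measure X, IsProbabilityMeasure μ →
      klDiv μ ν + ((∫ x, V x ∂μ : ℝ) : EReal) = ((-Real.log Z : ℝ) : EReal) →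
        μ = νstar := by
  intro μ hμ h
  obtain ⟨C, hC⟩ := hVbdd
  by_cases hk : μ ≪ ν ∧ Integrable (llr μ ν) μ
  swap
  · rw [klDiv, if_neg hk, EReal.top_add_coe] at h
    exact absurd h.symm (EReal.coe_ne_top _)
  rw [klDiv, if_pos hk, ← EReal.coe_add, EReal.coe_eq_coe_iff] at h
  obtain ⟨hac, hint⟩ := hk
  have hf : Integrable (fun x => Real.exp (-V x)) ν := by
    refine Integrable.of_bound (C := Real.exp C) (by fun_prop) (ae_of_all _ fun x => ?_)
    rw [Real.norm_eq_abs, Real.abs_exp, Real.exp_le_exp]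
    exact (neg_le_abs _).trans (hC x)
  have hfμ : Integrable (fun x => -V x) μ := by
    refine Integrable.of_bound (C := C) (by fun_prop) (ae_of_all _ fun x => ?_)
    rw [norm_neg]
    exact hC x
  have hst : νstar = ν.tilted (fun x => -V x) := by
    rw [hνstar, hZ]; rfl
  have hp : IsProbabilityMeasure (ν.tilted (fun x => -V x)) := isProbabilityMeasure_tilted hf
  have key := integral_llr_tilted_right hac hfμ hf hint
  have hac' := hac.trans (absolutelyContinuous_tilted hf)
  have hint' := integrable_llr_tilted_right hac hfμ hint hf
  rw [integral_neg, ← hZ] at key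
  rw [hst, ← InformationTheory.klDiv_eq_zero_iff,
    InformationTheory.klDiv_of_ac_of_integrable hac' hint', key]
  simp only [probReal_univ, ENNReal.ofReal_eq_zero]
  linarith
end

section
/- Let X be a standard Borel space, N a positive integer, ℓ_k : X → ℝ bounded measurable functions for k = 0,…,N, and κ̄_k (k = 0,…,N−1) Markov kernels from X to X. Define the desirability function Z backward by Z(N,x) = exp(−ℓ_N(x)) and Z(k,x) = exp(−ℓ_k(x)) ∫ Z(k+1,y) κ̄_k(x,dy). For any family μ = (μ_k)_{k=0}^{N−1} of Markov kernels from X to X, define the cost-to-go recursively by J_μ(N,x) = ℓ_N(x) and J_μ(k,x) = ℓ_k(x) + KL(μ_k(x)‖κ̄_k(x)) + ∫ J_μ(k+1,y) μ_k(x,dy), with values in (−∞,+∞]. Then for every k ∈ {0,…,N} and x ∈ X, the infimum of J_μ(k,x) over all such families μ equals −log Z(k,x), and it is attained by the tilted kernels μ*_k, where μ*_k(x) is the probability measure with density y ↦ Z(k+1,y) / (∫ Z(k+1,y') κ̄_k(x,dy')) with respect to κ̄_k(x). -/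
open MeasureTheory ProbabilityTheory

/- The canonical map `EReal → ℝ≥0∞` (sending negative values to `0`). -/
open Classical in
noncomputable def erealToENNReal (x : EReal) : ENNReal :=
  if x = ⊤ then ⊤ else ENNReal.ofReal x.toReal

/- Integral of an `EReal`-valued function: positive part minus negative part
(well suited for functions bounded from below, with values in `(−∞, +∞]`). -/
noncomputable def eIntegral {X : Type*} [MeasurableSpace X] (μ : Measure X)
    (f : X → EReal) : EReal :=
  ((∫⁻ x, erealToENNReal (f x) ∂μ : ENNReal) : EReal) -
    ((∫⁻ x, erealToENNReal (-(f x)) ∂μ : ENNReal) : EReal)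

lemma eI_mono {X : Type*} [MeasurableSpace X] (μ : Measure X) {f g : X → EReal}
    (h : ∀ x, f x ≤ g x) : eIntegral μ f ≤ eIntegral μ g := by
  have hm : ∀ {a b : EReal}, a ≤ b → erealToENNReal a ≤ erealToENNReal b := by
    intro a b hab
    exact EReal.toENNReal_le_toENNReal hab
  unfold eIntegral
  refine EReal.sub_le_sub ?_ ?_
  · exact EReal.coe_ennreal_le_coe_ennreal_iff.2 (lintegral_mono fun x => hm (h x))
  · exact EReal.coe_ennreal_le_coe_ennreal_iff.2
      (lintegral_mono fun x => hm (EReal.neg_le_neg_iff.2 (h x)))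

lemma eI_coe {X : Type*} [MeasurableSpace X] (μ : Measure X) {f : X → ℝ}
    (h : Integrable f μ) : eIntegral μ (fun x => (f x : EReal)) = ((∫ x, f x ∂μ : ℝ) : EReal) := by
  have hm : ∀ a : ℝ, erealToENNReal (a : EReal) = ENNReal.ofReal a := by
    intro a
    simp [erealToENNReal]
  have hp : ∫⁻ x, ENNReal.ofReal (f x) ∂μ ≠ ⊤ := h.lintegral_lt_top.ne
  have hn : ∫⁻ x, ENNReal.ofReal (-(f x)) ∂μ ≠ ⊤ := h.neg.lintegral_lt_top.ne
  unfold eIntegral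
  rw [integral_eq_lintegral_pos_part_sub_lintegral_neg_part h]
  simp only [← EReal.coe_neg, hm]
  rw [EReal.coe_sub, EReal.coe_ennreal_toReal hp, EReal.coe_ennreal_toReal hn]

lemma bdd_int {X : Type*} [MeasurableSpace X] (μ : Measure X) [IsFiniteMeasure μ] {V : X → ℝ}
    (hV : Measurable V) {C : ℝ} (hC : ∀ x, |V x| ≤ C) : Integrable V μ :=
  Integrable.of_bound hV.aestronglyMeasurable C (Filter.Eventually.of_forall hC)

lemma exp_int {X : Type*} [MeasurableSpace X] (μ : Measure X) [IsFiniteMeasure μ] {V : X → ℝ}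
    (hV : Measurable V) {C : ℝ} (hC : ∀ x, |V x| ≤ C) :
    Integrable (fun x => Real.exp (-V x)) μ := by
  refine Integrable.of_bound (by fun_prop) (Real.exp C) (Filter.Eventually.of_forall fun x => ?_)
  rw [Real.norm_eq_abs, Real.abs_exp]
  exact Real.exp_le_exp.2 (by linarith [(abs_le.1 (hC x)).1])

lemma kl_lower {X : Type*} [MeasurableSpace X] (μ κ : Measure X) [IsProbabilityMeasure μ]
    [IsProbabilityMeasure κ] {V : X → ℝ} (hV : Measurable V) {C : ℝ} (hC : ∀ x, |V x| ≤ C)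
    (l : ℝ) : ((l - Real.log (∫ x, Real.exp (-V x) ∂κ) : ℝ) : EReal) ≤
      (l : EReal) + klDiv μ κ + ((∫ x, V x ∂μ : ℝ) : EReal) := by
  unfold klDiv
  split_ifs with h
  · obtain ⟨hac, hint⟩ := h
    have he := exp_int κ hV hC
    have hVi := bdd_int μ hV hC
    have h1 := integral_llr_tilted_right (f := fun x => -V x) hac hVi.neg he hint
    have := isProbabilityMeasure_tilted (μ := κ) he
    have h2 := InformationTheory.integral_llr_add_sub_measure_univ_nonneg
      (hac.trans (absolutelyContinuous_tilted he))
      (integrable_llr_tilted_right (f := fun x => -V x) hac hVi.neg hint he)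
    simp only [probReal_univ, integral_neg] at h1 h2
    rw [← EReal.coe_add, ← EReal.coe_add, EReal.coe_le_coe_iff]
    linarith
  · simp

lemma kl_tilt {X : Type*} [MeasurableSpace X] (κ : Measure X)
    [IsProbabilityMeasure κ] {V : X → ℝ} (hV : Measurable V) {C : ℝ} (hC : ∀ x, |V x| ≤ C)
    (l : ℝ) : ((l - Real.log (∫ x, Real.exp (-V x) ∂κ) : ℝ) : EReal) =
      (l : EReal) + klDiv (κ.tilted fun x => -V x) κ +
        ((∫ x, V x ∂(κ.tilted fun x => -V x) : ℝ) : EReal) := by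
  have he := exp_int κ hV hC
  have := isProbabilityMeasure_tilted (μ := κ) he
  have hVi := bdd_int (κ.tilted fun x => -V x) hV hC
  have hac := tilted_absolutelyContinuous κ (fun x => -V x)
  have hl : llr (κ.tilted fun x => -V x) κ =ᵐ[κ.tilted fun x => -V x]
      fun x => -V x - Real.log (∫ x, Real.exp (-V x) ∂κ) :=
    hac.ae_le (log_rnDeriv_tilted_left_self he)
  have hi : Integrable (llr (κ.tilted fun x => -V x) κ) (κ.tilted fun x => -V x) :=
    (integrable_congr hl).2 (hVi.neg.sub (integrable_const _))
  unfold klDiv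
  rw [if_pos ⟨hac, hi⟩, integral_congr_ae hl, integral_sub (f := fun x => -V x) hVi.neg (integrable_const _),
    integral_neg, ← EReal.coe_add, ← EReal.coe_add, EReal.coe_eq_coe_iff, integral_const, probReal_univ, one_smul]
  ring

/-- Dynamic programming for KL control: the infimum of the cost-to-go `J_μ(k,x)` over
all families of Markov kernels `μ` equals `−log Z(k,x)`, and it is attained by the
tilted kernels `μ*`. -/
theorem stmt_3 {X : Type*} [MeasurableSpace X] [StandardBorelSpace X]
    (N : ℕ) (hN : 0 < N) (ℓ : ℕ → X → ℝ)
    (hℓ_meas : ∀ k ≤ N, Measurable (ℓ k)) (hℓ_bdd : ∀ k ≤ N, ∃ C : ℝ, ∀ x, |ℓ k x| ≤ C)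
    (κ : ℕ → Kernel X X) (hκ : ∀ k < N, IsMarkovKernel (κ k))
    (Z : ℕ → X → ℝ)
    (hZN : ∀ x, Z N x = Real.exp (-ℓ N x))
    (hZk : ∀ k < N, ∀ x, Z k x = Real.exp (-ℓ k x) * ∫ y, Z (k + 1) y ∂(κ k x)) :
    ∀ k ≤ N, ∀ x : X,
      IsLeast {r : EReal | ∃ (μ : ℕ → Kernel X X) (J : ℕ → X → EReal),
          (∀ s < N, IsMarkovKernel (μ s)) ∧
          (∀ y, J N y = ((ℓ N y : ℝ) : EReal)) ∧
          (∀ s < N, ∀ y, J s y = ((ℓ s y : ℝ) : EReal) + klDiv (μ s y) (κ s y) +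
            eIntegral (μ s y) (J (s + 1))) ∧
          r = J k x}
        ((-Real.log (Z k x) : ℝ) : EReal) ∧
      ∃ (μstar : ℕ → Kernel X X) (Jstar : ℕ → X → EReal),
        (∀ s < N, IsMarkovKernel (μstar s)) ∧
        (∀ s < N, ∀ y, μstar s y = (κ s y).withDensity
          (fun y' => ENNReal.ofReal (Z (s + 1) y' / ∫ y'', Z (s + 1) y'' ∂(κ s y)))) ∧
        (∀ y, Jstar N y = ((ℓ N y : ℝ) : EReal)) ∧
        (∀ s < N, ∀ y, Jstar s y = ((ℓ s y : ℝ) : EReal) + klDiv (μstar s y) (κ s y) +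
          eIntegral (μstar s y) (Jstar (s + 1))) ∧
        Jstar k x = ((-Real.log (Z k x) : ℝ) : EReal) := by
  have key : ∀ j ≤ N, ∃ V : X → ℝ, Measurable V ∧ (∃ C, ∀ x, |V x| ≤ C) ∧
      Z (N - j) = fun x => Real.exp (-V x) := by
    intro j
    induction j with
    | zero =>
      intro _
      exact ⟨ℓ N, hℓ_meas N le_rfl, hℓ_bdd N le_rfl, funext hZN⟩
    | succ j ih =>
      intro hj
      obtain ⟨V, hV, ⟨C, hC⟩, hZ⟩ := ih (by omega)
      have hs : N - (j + 1) < N := by omega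
      have hs1 : N - j = (N - (j + 1)) + 1 := by omega
      rw [hs1] at hZ
      generalize N - (j + 1) = s at hs hZ
      have := hκ s hs
      obtain ⟨D, hD⟩ := hℓ_bdd s hs.le
      have hlo : ∀ x, Real.exp (-C) ≤ ∫ y, Real.exp (-V y) ∂(κ s x) := by
        intro x
        have := integral_mono (μ := κ s x) (integrable_const (Real.exp (-C))) (exp_int _ hV hC)
          (fun y => Real.exp_le_exp.2 (by linarith [(abs_le.1 (hC y)).2]))
        simpa using this
      have hhi : ∀ x, ∫ y, Real.exp (-V y) ∂(κ s x) ≤ Real.exp C := by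
        intro x
        have := integral_mono (μ := κ s x) (exp_int _ hV hC) (integrable_const (Real.exp C))
          (fun y => Real.exp_le_exp.2 (by linarith [(abs_le.1 (hC y)).1]))
        simpa using this
      have hpos : ∀ x, 0 < ∫ y, Real.exp (-V y) ∂(κ s x) := fun x =>
        (Real.exp_pos _).trans_le (hlo x)
      have hm : Measurable fun x => ∫ y, Real.exp (-V y) ∂(κ s x) :=
        (StronglyMeasurable.integral_kernel (κ := κ s) (f := fun y => Real.exp (-V y))
          (by fun_prop)).measurable
      refine ⟨fun x => ℓ s x - Real.log (∫ y, Real.exp (-V y) ∂(κ s x)),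
        (hℓ_meas s hs.le).sub hm.log, ⟨D + C, fun x => ?_⟩, ?_⟩
      · have h1 := Real.log_le_log (Real.exp_pos _) (hlo x)
        have h2 := Real.log_le_log (hpos x) (hhi x)
        rw [Real.log_exp] at h1 h2
        have h3 := abs_le.1 (hD x)
        exact abs_le.2 ⟨by linarith, by linarith⟩
      · funext x
        rw [hZk s hs x, hZ, neg_sub, sub_eq_neg_add, Real.exp_add, Real.exp_log (hpos x)]
  have key2 : ∀ s ≤ N, Measurable (fun x => -Real.log (Z s x)) ∧
      (∃ C, ∀ x, |-Real.log (Z s x)| ≤ C) ∧ ∀ x, Z s x = Real.exp (-(-Real.log (Z s x))) := by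
    intro s hs
    obtain ⟨V, hV, hC, hZ⟩ := key (N - s) (by omega)
    rw [show N - (N - s) = s by omega] at hZ
    have : ∀ x, -Real.log (Z s x) = V x := by intro x; rw [hZ]; simp
    simp only [this]
    exact ⟨hV, hC, fun x => congrFun hZ x⟩
  clear key
  obtain ⟨V, hVdef⟩ : ∃ V : ℕ → X → ℝ, V = fun s x => -Real.log (Z s x) := ⟨_, rfl⟩
  have hVd : ∀ s x, -Real.log (Z s x) = V s x := fun s x => by rw [hVdef]
  simp only [hVd] at key2 ⊢
  have hVN : ∀ x, V N x = ℓ N x := by intro x; rw [← hVd, hZN]; simp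
  have hVs : ∀ s < N, ∀ x, V s x = ℓ s x - Real.log (∫ y, Real.exp (-V (s + 1) y) ∂(κ s x)) := by
    intro s hs x
    have := hκ s hs
    obtain ⟨hm, ⟨C, hC⟩, hZ⟩ := key2 (s + 1) hs
    have hp : 0 < ∫ y, Real.exp (-V (s + 1) y) ∂(κ s x) := integral_exp_pos (exp_int _ hm hC)
    rw [← hVd, hZk s hs x]
    simp only [hZ]
    rw [Real.log_mul (Real.exp_ne_zero _) hp.ne', Real.log_exp]
    ring
  have hker : ∀ s, ∃ m : Kernel X X, s < N → IsMarkovKernel m ∧ ∀ y,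
      m y = (κ s y).tilted (fun y' => -V (s + 1) y') := by
    intro s
    by_cases hs : s < N
    · have := hκ s hs
      obtain ⟨hm, ⟨C, hC⟩, hZ⟩ := key2 (s + 1) hs
      have hI : Measurable fun x => ∫ y, Real.exp (-V (s + 1) y) ∂(κ s x) :=
        (StronglyMeasurable.integral_kernel (κ := κ s) (f := fun y => Real.exp (-V (s + 1) y))
          (by fun_prop)).measurable
      have heq : ∀ y, (Kernel.withDensity (κ s) (fun x y' => ENNReal.ofReal
          (Real.exp (-V (s + 1) y') / ∫ y, Real.exp (-V (s + 1) y) ∂(κ s x)))) y =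
          (κ s y).tilted (fun y' => -V (s + 1) y') := by
        intro y
        rw [Kernel.withDensity_apply]
        · rfl
        · exact (((hm.comp measurable_snd).neg.exp).div (hI.comp measurable_fst)).ennreal_ofReal
      refine ⟨_, fun _ => ⟨⟨fun y => ?_⟩, heq⟩⟩
      rw [heq]
      exact isProbabilityMeasure_tilted (exp_int _ hm hC)
    · exact ⟨0, fun h => absurd h hs⟩
  choose m hmk using hker
  have hrec : ∀ s < N, ∀ y, ((V s y : ℝ) : EReal) = ((ℓ s y : ℝ) : EReal) +
      klDiv (m s y) (κ s y) + eIntegral (m s y) (fun z => ((V (s + 1) z : ℝ) : EReal)) := by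
    intro s hs y
    have := hκ s hs
    have := (hmk s hs).1
    obtain ⟨hm, ⟨C, hC⟩, hZ⟩ := key2 (s + 1) hs
    rw [eI_coe _ (bdd_int _ hm hC), (hmk s hs).2, hVs s hs]
    exact kl_tilt (κ s y) hm hC _
  intro k hk x
  refine ⟨⟨⟨m, fun s y => (V s y : EReal), fun s hs => (hmk s hs).1, fun y => by simp only [hVN],
    hrec, rfl⟩, ?_⟩, m, fun s y => (V s y : EReal), fun s hs => (hmk s hs).1, ?_,
    fun y => by simp only [hVN], hrec, rfl⟩
  · rintro r ⟨μ, J, hμ, hJN, hJ, rfl⟩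
    have : ∀ j ≤ N, ∀ x, (V (N - j) x : EReal) ≤ J (N - j) x := by
      intro j
      induction j with
      | zero =>
        intro _ x
        simp [hJN, hVN]
      | succ j ih =>
        intro hj x
        have ih := ih (by omega)
        have hs : N - (j + 1) < N := by omega
        have hs1 : N - j = (N - (j + 1)) + 1 := by omega
        rw [hs1] at ih
        generalize N - (j + 1) = s at hs ih
        have := hκ s hs
        have := hμ s hs
        obtain ⟨hm, ⟨C, hC⟩, hZ⟩ := key2 (s + 1) hs
        rw [hJ s hs, hVs s hs]
        refine (kl_lower (μ s x) (κ s x) hm hC _).trans ?_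
        rw [← eI_coe _ (bdd_int _ hm hC)]
        exact add_le_add le_rfl (eI_mono _ ih)
    have h := this (N - k) (by omega) x
    rwa [show N - (N - k) = k by omega] at h
  · intro s hs y
    have hZ : Z (s + 1) = fun y => Real.exp (-V (s + 1) y) := funext (key2 (s + 1) hs).2.2
    rw [(hmk s hs).2, hZ]
    rfl
end

section
/- Let p be a probability density on ℝⁿ, z : ℝⁿ → (0,∞) measurable, x ∈ ℝⁿ fixed, f₀ : ℝⁿ → ℝⁿ, and g(x) an invertible n×n real matrix. Suppose c := ∫ p(v) z(f₀(x) + g(x)v) dv is finite and positive. Let w have density p and, conditional on w = ω, let u have density u ↦ p(u+ω) z(f₀(x) + g(x)(u+ω))/c. Then the random variable x' := f₀(x) + g(x)(u + w) has density x' ↦ ρ⁰(x'|x) z(x') / ∫ ρ⁰(y|x) z(y) dy, where ρ⁰(y|x) := |det g(x)|⁻¹ p(g(x)⁻¹(y − f₀(x))) is the density of f₀(x) + g(x)w. That is, a noncausal policy that observes the noise w can realize exactly the tilted uncontrolled transition density required for optimality in Kullback–Leibler control. -/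
open MeasureTheory Matrix

theorem map_T_aux {n : ℕ} (a : Fin n → ℝ) (g : Matrix (Fin n) (Fin n) ℝ) (hg : g.det ≠ 0) :
    (volume : Measure (Fin n → ℝ)).map (fun v => a + g.mulVec v) =
      ENNReal.ofReal |g.det|⁻¹ • volume := by
  have h1 := Real.map_matrix_volume_pi_eq_smul_volume_pi hg
  have hm : Measurable (fun v : Fin n → ℝ => g.mulVec v) :=
    (Continuous.matrix_mulVec continuous_const continuous_id).measurable
  have h2 : (fun v : Fin n → ℝ => a + g.mulVec v) = (fun y => a + y) ∘ (fun v => g.mulVec v) := rfl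
  have h3 : (volume : Measure (Fin n → ℝ)).map (fun v => g.mulVec v) =
      ENNReal.ofReal |g.det|⁻¹ • volume := by
    rw [← abs_inv, ← h1]
    rfl
  rw [h2, ← Measure.map_map (measurable_const_add a) hm, h3, Measure.map_smul,
    map_add_left_eq_self]

/-- A noncausal policy that observes the noise `w` realizes exactly the tilted
uncontrolled transition density `x' ↦ ρ⁰(x'|x) z(x') / ∫ ρ⁰(y|x) z(y) dy` required for
optimality in Kullback–Leibler control. -/
theorem stmt_8 {n : ℕ} (p z' : (Fin n → ℝ) → ℝ)
    (hp_meas : Measurable p) (hp0 : ∀ v, 0 ≤ p v) (hp1 : ∫ v, p v = 1)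
    (hz_meas : Measurable z') (hz_pos : ∀ v, 0 < z' v)
    (x : Fin n → ℝ) (f0 : (Fin n → ℝ) → (Fin n → ℝ)) (g : Matrix (Fin n) (Fin n) ℝ)
    (hg : IsUnit g.det)
    (hint : Integrable (fun v => p v * z' (f0 x + g.mulVec v)))
    (c : ℝ) (hc : c = ∫ v, p v * z' (f0 x + g.mulVec v)) (hc_pos : 0 < c)
    (μ : Measure ((Fin n → ℝ) × (Fin n → ℝ)))
    (hμ : μ = volume.withDensity (fun q => ENNReal.ofReal
      (p q.1 * (p (q.2 + q.1) * z' (f0 x + g.mulVec (q.2 + q.1)) / c))))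
    (ρ0 : (Fin n → ℝ) → ℝ)
    (hρ0 : ∀ y, ρ0 y = |g.det|⁻¹ * p (g⁻¹.mulVec (y - f0 x))) :
    μ.map (fun q => f0 x + g.mulVec (q.2 + q.1)) =
      volume.withDensity (fun x' => ENNReal.ofReal (ρ0 x' * z' x' / ∫ y, ρ0 y * z' y)) := by
  have hd : g.det ≠ 0 := hg.ne_zero
  have hd' : 0 < |g.det|⁻¹ := by positivity
  have hT := map_T_aux (f0 x) g hd
  have hTm : Measurable (fun v : Fin n → ℝ => f0 x + g.mulVec v) :=
    (continuous_const.add (Continuous.matrix_mulVec continuous_const continuous_id)).measurable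
  have hgi : Measurable (fun v : Fin n → ℝ => g⁻¹.mulVec (v - f0 x)) :=
    (Continuous.matrix_mulVec continuous_const (continuous_id.sub continuous_const)).measurable
  have hρm : Measurable ρ0 := by
    have : ρ0 = fun y => |g.det|⁻¹ * p (g⁻¹.mulVec (y - f0 x)) := funext hρ0
    rw [this]
    exact (hp_meas.comp hgi).const_mul _
  have hρT : ∀ v, ρ0 (f0 x + g.mulVec v) = |g.det|⁻¹ * p v := by
    intro v
    rw [hρ0, add_sub_cancel_left, Matrix.mulVec_mulVec, Matrix.nonsing_inv_mul g hg,
      Matrix.one_mulVec]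
  have hC : ∫ y, ρ0 y * z' y = c := by
    have h1 : ∫ v, ρ0 (f0 x + g.mulVec v) * z' (f0 x + g.mulVec v) =
        |g.det|⁻¹ * ∫ y, ρ0 y * z' y := by
      rw [← integral_map (f := fun y => ρ0 y * z' y) hTm.aemeasurable
        (hρm.mul hz_meas).aestronglyMeasurable, hT, integral_smul_measure,
        ENNReal.toReal_ofReal hd'.le, smul_eq_mul]
    simp only [hρT, mul_assoc] at h1
    rw [integral_const_mul, ← hc] at h1
    exact (mul_left_cancel₀ hd'.ne' h1).symm
  have hpl : ∫⁻ v, ENNReal.ofReal (p v) = 1 := by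
    rw [← ofReal_integral_eq_lintegral_ofReal _ (Filter.Eventually.of_forall hp0), hp1,
      ENNReal.ofReal_one]
    by_contra h
    rw [integral_undef h] at hp1
    exact zero_ne_one hp1
  have hQ : Measurable (fun q : (Fin n → ℝ) × (Fin n → ℝ) => f0 x + g.mulVec (q.2 + q.1)) :=
    hTm.comp (measurable_snd.add measurable_fst)
  rw [hC, hμ]
  ext s hs
  rw [Measure.map_apply hQ hs, withDensity_apply _ (hQ hs), withDensity_apply _ hs,
    ← lintegral_indicator (hQ hs), ← lintegral_indicator hs]
  set F : (Fin n → ℝ) → ENNReal := s.indicator fun y => ENNReal.ofReal (ρ0 y * z' y / c) with hF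
  set H : (Fin n → ℝ) → ENNReal := fun v => s.indicator
    (fun y => ENNReal.ofReal (p v * z' y / c)) (f0 x + g.mulVec v) with hH
  have hFm : Measurable F := ((hρm.mul hz_meas).div_const c).ennreal_ofReal.indicator hs
  have hHe : H = ((fun v => f0 x + g.mulVec v) ⁻¹' s).indicator
      (fun v => ENNReal.ofReal (p v * z' (f0 x + g.mulVec v) / c)) := by
    ext v
    by_cases hv : f0 x + g.mulVec v ∈ s <;> simp [hH, Set.indicator, hv]
  have hHm : Measurable H := by
    rw [hHe]
    exact ((hp_meas.mul (hz_meas.comp hTm)).div_const c).ennreal_ofReal.indicator (hTm hs)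
  have hFH : ∀ v, F (f0 x + g.mulVec v) = ENNReal.ofReal |g.det|⁻¹ * H v := by
    intro v
    by_cases hv : f0 x + g.mulVec v ∈ s
    · simp only [hF, hH, Set.indicator, hv, if_true]
      rw [hρT, ← ENNReal.ofReal_mul hd'.le]
      congr 1
      ring
    · simp [hF, hH, Set.indicator, hv]
  have hR : ∫⁻ y, F y = ∫⁻ v, H v := by
    have h1 : ∫⁻ v, F (f0 x + g.mulVec v) = ENNReal.ofReal |g.det|⁻¹ * ∫⁻ y, F y := by
      rw [← lintegral_map hFm hTm, hT, lintegral_smul_measure, smul_eq_mul]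
    simp only [hFH] at h1
    rw [lintegral_const_mul _ hHm] at h1
    exact ((ENNReal.mul_right_inj (ENNReal.ofReal_pos.2 hd').ne' ENNReal.ofReal_ne_top).1 h1).symm
  rw [hR]
  have hL : ∀ q : (Fin n → ℝ) × (Fin n → ℝ),
      ((fun q : (Fin n → ℝ) × (Fin n → ℝ) => f0 x + g.mulVec (q.2 + q.1)) ⁻¹' s).indicator
      (fun q => ENNReal.ofReal
        (p q.1 * (p (q.2 + q.1) * z' (f0 x + g.mulVec (q.2 + q.1)) / c))) q =
      ENNReal.ofReal (p q.1) * H (q.2 + q.1) := by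
    intro q
    by_cases hv : f0 x + g.mulVec (q.2 + q.1) ∈ s
    · simp only [hH, Set.indicator, Set.mem_preimage, hv, if_true]
      rw [ENNReal.ofReal_mul (hp0 _)]
    · simp only [hH, Set.indicator, Set.mem_preimage, hv, if_false, mul_zero]
  rw [lintegral_congr hL, Measure.volume_eq_prod, lintegral_prod]
  · have : ∀ w : Fin n → ℝ, ∫⁻ u, ENNReal.ofReal (p w) * H (u + w) =
        ENNReal.ofReal (p w) * ∫⁻ v, H v := by
      intro w
      rw [lintegral_const_mul (f := fun u => H (u + w)) _ (hHm.comp (measurable_add_const w)),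
        lintegral_add_right_eq_self H w]
    simp only [this]
    rw [lintegral_mul_const _ hp_meas.ennreal_ofReal, hpl, one_mul]
  · exact ((hp_meas.comp measurable_fst).ennreal_ofReal.mul
      (hHm.comp (measurable_snd.add measurable_fst))).aemeasurable
end

section
/- Let Σ and P be symmetric positive definite n×n real matrices, A and B real n×n matrices, and x ∈ ℝⁿ. Then ∫_{ℝⁿ} N(u | 0, Σ) · exp(−½ (Ax + Bu)ᵀ P (Ax + Bu)) du = det(I + P B Σ Bᵀ)^{−1/2} · exp(−½ xᵀ (AᵀPA − AᵀPB (Σ^{−1} + BᵀPB)^{−1} BᵀPA) x). -/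
open Matrix MeasureTheory

/- The `n`-dimensional Gaussian density `N(x | m, S)` for positive definite `S`. -/
noncomputable def gaussDensity {n : ℕ} (m : Fin n → ℝ) (S : Matrix (Fin n) (Fin n) ℝ)
    (x : Fin n → ℝ) : ℝ :=
  (Real.sqrt ((2 * Real.pi) ^ n * S.det))⁻¹ *
    Real.exp (-(1 / 2) * ((x - m) ⬝ᵥ S⁻¹.mulVec (x - m)))


lemma stdG (n : ℕ) : ∫ v : Fin n → ℝ, Real.exp (-(1/2) * (v ⬝ᵥ v)) = √(2*Real.pi)^n := by
  have h := integral_fintype_prod_volume_eq_pow (ι := Fin n) (fun x : ℝ => Real.exp (-(1/2) * x^2))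
  rw [integral_gaussian, Fintype.card_fin] at h
  rw [show 2 * Real.pi = Real.pi / (1/2) by ring, ← h]
  congr 1; ext v
  rw [← Real.exp_sum, dotProduct, Finset.mul_sum]
  simp only [sq]

lemma lin {n : ℕ} (C : Matrix (Fin n) (Fin n) ℝ) (hC : C.det ≠ 0) :
    ∫ u : Fin n → ℝ, Real.exp (-(1/2) * (C.mulVec u ⬝ᵥ C.mulVec u)) = |C.det|⁻¹ * √(2*Real.pi)^n := by
  have h := Real.map_matrix_volume_pi_eq_smul_volume_pi hC
  have h2 : ∫ v : Fin n → ℝ, Real.exp (-(1/2) * (v ⬝ᵥ v)) ∂(Measure.map (toLin' C) volume) =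
     |C.det|⁻¹ * √(2*Real.pi)^n := by
    rw [h, integral_smul_measure, stdG, smul_eq_mul, ENNReal.toReal_ofReal (abs_nonneg _), abs_inv]
  rw [← h2, integral_map]
  · simp
  · exact (LinearMap.continuous_of_finiteDimensional _).aemeasurable
  · apply Continuous.aestronglyMeasurable
    unfold dotProduct
    fun_prop

open scoped MatrixOrder Matrix.Norms.L2Operator in
lemma quad {n : ℕ} (M : Matrix (Fin n) (Fin n) ℝ) (hM : M.PosDef) :
    ∫ u : Fin n → ℝ, Real.exp (-(1/2) * (u ⬝ᵥ M.mulVec u)) = (√M.det)⁻¹ * √(2*Real.pi)^n := by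
  obtain ⟨C, hC⟩ : ∃ C : Matrix (Fin n) (Fin n) ℝ, M = Cᵀ * C := by
    have := (CStarAlgebra.nonneg_iff_eq_star_mul_self (a := M)).mp (by exact hM.posSemidef.nonneg)
    obtain ⟨C, hC⟩ := this
    exact ⟨C, by simpa [star_eq_conjTranspose] using hC⟩
  have hd : M.det = C.det * C.det := by rw [hC, det_mul, det_transpose]
  have h0 : C.det ≠ 0 := by
    intro h; have := hM.det_pos; rw [hd, h] at this; simp at this
  rw [hd, Real.sqrt_mul_self_eq_abs, ← lin C h0]
  congr 1; ext u
  rw [hC, ← mulVec_mulVec, dotProduct_mulVec u, vecMul_transpose]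


/-- Gaussian integral appearing in the LQG desirability recursion. -/
theorem stmt_11 {n : ℕ} (S P A B : Matrix (Fin n) (Fin n) ℝ)
    (hS : S.PosDef) (hP : P.PosDef) (x : Fin n → ℝ) :
    ∫ u : Fin n → ℝ,
        gaussDensity 0 S u *
          Real.exp (-(1 / 2) *
            ((A.mulVec x + B.mulVec u) ⬝ᵥ P.mulVec (A.mulVec x + B.mulVec u))) =
      (Real.sqrt ((1 + P * B * S * Bᵀ).det))⁻¹ *
        Real.exp (-(1 / 2) *
          (x ⬝ᵥ (Aᵀ * P * A - Aᵀ * P * B * (S⁻¹ + Bᵀ * P * B)⁻¹ * Bᵀ * P * A).mulVec x)) := by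
  unfold gaussDensity
  have hPt : Pᵀ = P := by simpa using hP.isHermitian.eq
  have hSt : Sᵀ = S := by simpa using hS.isHermitian.eq
  obtain ⟨M, hMd⟩ : ∃ M, M = S⁻¹ + Bᵀ * P * B := ⟨_, rfl⟩
  have hM : M.PosDef := by
    rw [hMd]
    refine hS.inv.add_posSemidef ?_
    simpa using hP.posSemidef.conjTranspose_mul_mul_same B
  have hMt : Mᵀ = M := by simpa using hM.isHermitian.eq
  have hMu : IsUnit M.det := hM.det_pos.ne'.isUnit
  have hSu : IsUnit S.det := hS.det_pos.ne'.isUnit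
  have hdet : (1 + P * B * S * Bᵀ).det = M.det * S.det := by
    rw [det_one_add_mul_comm, ← det_mul, hMd, add_mul, nonsing_inv_mul _ hSu]
    simp only [Matrix.mul_assoc]
  rw [← hMd, hdet]
  obtain ⟨w, hw⟩ : ∃ w, w = M⁻¹ *ᵥ (Bᵀ *ᵥ (P *ᵥ (A *ᵥ x))) := ⟨_, rfl⟩
  have hMw : M *ᵥ w = Bᵀ *ᵥ (P *ᵥ (A *ᵥ x)) := by
    rw [hw, mulVec_mulVec, mul_nonsing_inv _ hMu, one_mulVec]
  have sym : ∀ (Q : Matrix (Fin n) (Fin n) ℝ) (a b : Fin n → ℝ), a ⬝ᵥ Q *ᵥ b = b ⬝ᵥ Qᵀ *ᵥ a := by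
    intro Q a b
    rw [dotProduct_mulVec, ← mulVec_transpose, dotProduct_comm]
  have hR : x ⬝ᵥ (Aᵀ * P * A - Aᵀ * P * B * M⁻¹ * Bᵀ * P * A) *ᵥ x =
      (A *ᵥ x) ⬝ᵥ P *ᵥ (A *ᵥ x) - w ⬝ᵥ M *ᵥ w := by
    rw [hMw, sub_mulVec, dotProduct_sub]
    simp only [Matrix.mul_assoc, ← mulVec_mulVec]
    rw [← hw, sym Aᵀ, sym Aᵀ, transpose_transpose, sym Bᵀ, transpose_transpose, dotProduct_comm (P *ᵥ (B *ᵥ w)), sym P (A *ᵥ x) (B *ᵥ w), hPt,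
      dotProduct_comm (B *ᵥ w),
      dotProduct_comm (A *ᵥ x) (P *ᵥ (A *ᵥ x))]
  have key : ∀ u : Fin n → ℝ, u ⬝ᵥ S⁻¹ *ᵥ u + (A *ᵥ x + B *ᵥ u) ⬝ᵥ P *ᵥ (A *ᵥ x + B *ᵥ u) =
      (u + w) ⬝ᵥ M *ᵥ (u + w) + x ⬝ᵥ (Aᵀ * P * A - Aᵀ * P * B * M⁻¹ * Bᵀ * P * A) *ᵥ x := by
    intro u
    have e1 : w ⬝ᵥ M *ᵥ u = u ⬝ᵥ M *ᵥ w := by rw [sym, hMt]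
    have e2 : (A *ᵥ x) ⬝ᵥ P *ᵥ (B *ᵥ u) = u ⬝ᵥ M *ᵥ w := by
      rw [sym, hPt, hMw, sym Bᵀ, transpose_transpose, dotProduct_comm]
    have e3 : (B *ᵥ u) ⬝ᵥ P *ᵥ (A *ᵥ x) = u ⬝ᵥ M *ᵥ w := by rw [← e2, sym, hPt]
    have e4 : u ⬝ᵥ M *ᵥ u = u ⬝ᵥ S⁻¹ *ᵥ u + (B *ᵥ u) ⬝ᵥ P *ᵥ (B *ᵥ u) := by
      rw [hMd, add_mulVec, dotProduct_add]
      simp only [Matrix.mul_assoc, ← mulVec_mulVec]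
      rw [sym Bᵀ, transpose_transpose, dotProduct_comm (P *ᵥ _)]
    rw [hR]
    simp only [mulVec_add, dotProduct_add, add_dotProduct]
    rw [e1, e2, e3, e4]
    ring
  have : ∀ u : Fin n → ℝ, ((Real.sqrt ((2 * Real.pi) ^ n * S.det))⁻¹ *
    Real.exp (-(1 / 2) * ((u - 0) ⬝ᵥ S⁻¹.mulVec (u - 0)))) *
          Real.exp (-(1 / 2) *
            ((A.mulVec x + B.mulVec u) ⬝ᵥ P.mulVec (A.mulVec x + B.mulVec u))) = 
     ((Real.sqrt ((2 * Real.pi) ^ n * S.det))⁻¹ * Real.exp (-(1 / 2) * (x ⬝ᵥ (Aᵀ * P * A - Aᵀ * P * B * M⁻¹ * Bᵀ * P * A) *ᵥ x))) * 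
        Real.exp (-(1/2) * ((u + w) ⬝ᵥ M *ᵥ (u + w))) := by
    intro u
    rw [mul_assoc, mul_assoc, ← Real.exp_add, ← Real.exp_add, sub_zero, ← mul_add, ← mul_add, key, add_comm]
  simp_rw [this]
  rw [integral_const_mul, integral_add_right_eq_self (fun u => Real.exp (-(1/2) * (u ⬝ᵥ M *ᵥ u))) w,
    quad M hM, Real.sqrt_mul (by positivity), Real.sqrt_mul hM.det_pos.le]
  have hp : √((2 * Real.pi)^n) = √(2*Real.pi)^n := by
    rw [Real.sqrt_eq_iff_mul_self_eq (by positivity) (by positivity), ← mul_pow, Real.mul_self_sqrt (by positivity)]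
  rw [hp]
  have : √(2*Real.pi)^n ≠ 0 := by positivity
  field_simp
end

section
/- Let N be a positive integer, A and B real n×n matrices, and for k = 0,…,N let Q_k be symmetric positive definite n×n matrices and for k = 0,…,N−1 let Σ_k be symmetric positive definite n×n matrices. Define Z : {0,…,N} × ℝⁿ → ℝ backward by Z(N,x) = exp(−½ xᵀQ_N x) and Z(k,x) = exp(−½ xᵀQ_k x) · ∫_{ℝⁿ} Z(k+1, Ax + Bu) N(u | 0, Σ_k) du. Define P_k by the Riccati difference equation P_N = Q_N and P_k = Q_k + AᵀP_{k+1}A − AᵀP_{k+1}B (Σ_k^{−1} + BᵀP_{k+1}B)^{−1} BᵀP_{k+1}A for k = N−1,…,0. Then for all k ∈ {0,…,N} and all x ∈ ℝⁿ, Z(k,x) = (∏_{s=k+1}^{N} det(I + P_s B Σ_{s−1} Bᵀ)^{−1/2}) · exp(−½ xᵀ P_k x), with each P_k symmetric positive definite. -/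
open Matrix MeasureTheory

open scoped MatrixOrder in
lemma posDef_factor {n : ℕ} {M : Matrix (Fin n) (Fin n) ℝ} (hM : M.PosDef) :
    ∃ C : Matrix (Fin n) (Fin n) ℝ, C.det ≠ 0 ∧ M = Cᵀ * C := by
  obtain ⟨y, hy, h⟩ := CStarAlgebra.isStrictlyPositive_iff_eq_star_mul_self.mp
        hM.isStrictlyPositive
  refine ⟨y, ((Matrix.isUnit_iff_isUnit_det _).1 hy).ne_zero, ?_⟩
  rw [h, star_eq_conjTranspose, conjTranspose_eq_transpose_of_trivial]

lemma integral_std (n : ℕ) :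
    ∫ u : Fin n → ℝ, Real.exp (-(1/2) * (u ⬝ᵥ u)) = Real.sqrt ((2 * Real.pi) ^ n) := by
  have h : ∀ u : Fin n → ℝ, Real.exp (-(1/2) * (u ⬝ᵥ u)) = ∏ i, Real.exp (-(1/2) * (u i)^2) := by
    intro u
    rw [← Real.exp_sum, ← Finset.mul_sum]
    simp [dotProduct, sq]
  simp_rw [h]
  rw [integral_fintype_prod_volume_eq_pow (fun x : ℝ => Real.exp (-(1/2) * x^2)),
    integral_gaussian, Fintype.card_fin]
  have : Real.pi / (1/2) = 2 * Real.pi := by ring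
  rw [this]
  refine ((Real.sqrt_eq_iff_eq_sq (by positivity) (by positivity)).2 ?_).symm
  rw [← pow_mul, mul_comm n 2, pow_mul, Real.sq_sqrt (by positivity)]

lemma integral_gauss {n : ℕ} {M : Matrix (Fin n) (Fin n) ℝ} (hM : M.PosDef) :
    ∫ u : Fin n → ℝ, Real.exp (-(1/2) * (u ⬝ᵥ M.mulVec u)) =
      Real.sqrt ((2 * Real.pi) ^ n) / Real.sqrt M.det := by
  obtain ⟨C, hC, rfl⟩ := posDef_factor hM
  have h1 : ∀ u : Fin n → ℝ, u ⬝ᵥ (Cᵀ * C).mulVec u = (toLin' C u) ⬝ᵥ (toLin' C u) := by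
    intro u
    rw [toLin'_apply, ← mulVec_mulVec, dotProduct_mulVec, vecMul_transpose]
  simp_rw [h1]
  have hm : AEMeasurable (toLin' C) (volume : Measure (Fin n → ℝ)) :=
    (LinearMap.continuous_of_finiteDimensional _).aemeasurable
  have h2 := integral_map (μ := (volume : Measure (Fin n → ℝ))) hm
    (f := fun v : Fin n → ℝ => Real.exp (-(1/2) * (v ⬝ᵥ v)))
    (by
      apply Continuous.aestronglyMeasurable
      unfold dotProduct
      fun_prop)
  rw [← h2, Real.map_matrix_volume_pi_eq_smul_volume_pi hC, integral_smul_measure, integral_std,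
    ENNReal.toReal_ofReal (abs_nonneg _), det_mul, det_transpose, Real.sqrt_mul_self_eq_abs,
    abs_inv, smul_eq_mul]
  ring

lemma complete_sq {n : ℕ} {A B P S M : Matrix (Fin n) (Fin n) ℝ} (hP : Pᵀ = P)
    (hM : M = S⁻¹ + Bᵀ * P * B) (hMs : Mᵀ = M) (hMd : IsUnit M.det) (x u : Fin n → ℝ) :
    (A.mulVec x + B.mulVec u) ⬝ᵥ P.mulVec (A.mulVec x + B.mulVec u) + u ⬝ᵥ S⁻¹.mulVec u =
      (u + (M⁻¹ * Bᵀ * P * A).mulVec x) ⬝ᵥ M.mulVec (u + (M⁻¹ * Bᵀ * P * A).mulVec x) +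
      x ⬝ᵥ (Aᵀ * P * A - Aᵀ * P * B * M⁻¹ * Bᵀ * P * A).mulVec x := by
  have hS : S⁻¹ = M - Bᵀ * P * B := by rw [hM]; simp
  have hMi : M⁻¹ᵀ = M⁻¹ := by rw [transpose_nonsing_inv, hMs]
  have key : ∀ (X Y : Matrix (Fin n) (Fin n) ℝ) (a b : Fin n → ℝ),
      X.mulVec a ⬝ᵥ Y.mulVec b = a ⬝ᵥ (Xᵀ * Y).mulVec b := by
    intro X Y a b
    rw [← mulVec_mulVec, dotProduct_mulVec a, vecMul_transpose]
  have sw : ∀ (X : Matrix (Fin n) (Fin n) ℝ) (a b : Fin n → ℝ),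
      a ⬝ᵥ X.mulVec b = b ⬝ᵥ Xᵀ.mulVec a := by
    intro X a b
    rw [dotProduct_mulVec, mulVec_transpose, dotProduct_comm]
  have c1 : ∀ X : Matrix (Fin n) (Fin n) ℝ, M * (M⁻¹ * X) = X := fun X =>
    mul_nonsing_inv_cancel_left _ _ hMd
  rw [hS]
  simp only [mulVec_add, add_dotProduct, dotProduct_add, mulVec_mulVec, key, sub_mulVec,
    dotProduct_sub, transpose_mul, transpose_transpose, hP, hMi, Matrix.mul_assoc, c1]
  rw [sw (Aᵀ * (P * B)) x u]
  simp only [transpose_mul, transpose_transpose, hP, Matrix.mul_assoc]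
  have e : x ⬝ᵥ (Aᵀ * (P * (B * (M⁻¹ * M)))) *ᵥ u = u ⬝ᵥ (Bᵀ * (P * A)) *ᵥ x := by
    rw [nonsing_inv_mul _ hMd, Matrix.mul_one, sw]
    simp only [transpose_mul, transpose_transpose, hP, Matrix.mul_assoc]
  try rw [e]
  ring

lemma step_posDef {n : ℕ} {P B S : Matrix (Fin n) (Fin n) ℝ} (hP : P.PosDef) (hS : S.PosDef) :
    (S⁻¹ + Bᵀ * P * B).PosDef := by
  have := hP.posSemidef.conjTranspose_mul_mul_same B
  rw [conjTranspose_eq_transpose_of_trivial] at this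
  exact hS.inv.add_posSemidef this

lemma posDef_symm {n : ℕ} {P : Matrix (Fin n) (Fin n) ℝ} (hP : P.PosDef) : Pᵀ = P := by
  have := hP.isHermitian.eq
  rwa [conjTranspose_eq_transpose_of_trivial] at this

lemma step_P {n : ℕ} {A B P Q S : Matrix (Fin n) (Fin n) ℝ} (hP : P.PosDef) (hS : S.PosDef)
    (hQ : Q.PosDef) :
    (Q + Aᵀ * P * A - Aᵀ * P * B * (S⁻¹ + Bᵀ * P * B)⁻¹ * Bᵀ * P * A).PosDef := by
  have hMp := step_posDef (B := B) hP hS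
  obtain ⟨M, hM⟩ : ∃ M, M = S⁻¹ + Bᵀ * P * B := ⟨_, rfl⟩
  rw [← hM] at hMp ⊢
  have hPs := posDef_symm hP
  have hMs := posDef_symm hMp
  have hMi : M⁻¹ᵀ = M⁻¹ := by rw [transpose_nonsing_inv, hMs]
  rw [add_sub_assoc]
  refine hQ.add_posSemidef (PosSemidef.of_dotProduct_mulVec_nonneg ?_ ?_)
  · rw [IsHermitian, conjTranspose_eq_transpose_of_trivial]
    simp only [transpose_sub, transpose_mul, transpose_transpose, hPs, hMi, Matrix.mul_assoc]
  · intro x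
    have h := complete_sq (A := A) hPs hM hMs hMp.det_pos.ne'.isUnit x
      (-((M⁻¹ * Bᵀ * P * A).mulVec x))
    rw [neg_add_cancel, zero_dotProduct, zero_add] at h
    rw [star_trivial, ← h]
    refine add_nonneg ?_ ?_
    · simpa using hP.posSemidef.dotProduct_mulVec_nonneg (A *ᵥ x + B *ᵥ -((M⁻¹ * Bᵀ * P * A) *ᵥ x))
    · simpa using hS.inv.posSemidef.dotProduct_mulVec_nonneg (-((M⁻¹ * Bᵀ * P * A) *ᵥ x))

lemma step_int {n : ℕ} {A B P S : Matrix (Fin n) (Fin n) ℝ} (hP : P.PosDef) (hS : S.PosDef)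
    (c : ℝ) (x : Fin n → ℝ) :
    ∫ u : Fin n → ℝ, c * Real.exp (-(1 / 2) * ((A.mulVec x + B.mulVec u) ⬝ᵥ
        P.mulVec (A.mulVec x + B.mulVec u))) * gaussDensity 0 S u =
      (Real.sqrt ((1 + P * B * S * Bᵀ).det))⁻¹ * c * Real.exp (-(1 / 2) * (x ⬝ᵥ
        (Aᵀ * P * A - Aᵀ * P * B * (S⁻¹ + Bᵀ * P * B)⁻¹ * Bᵀ * P * A).mulVec x)) := by
  have hMp := step_posDef (B := B) hP hS
  have hdet : (1 + P * B * S * Bᵀ).det = S.det * (S⁻¹ + Bᵀ * P * B).det := by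
    rw [← det_mul, Matrix.mul_add, mul_nonsing_inv _ hS.det_pos.ne'.isUnit,
      Matrix.mul_assoc (P * B), det_one_add_mul_comm]
    simp only [Matrix.mul_assoc]
  obtain ⟨M, hM⟩ : ∃ M, M = S⁻¹ + Bᵀ * P * B := ⟨_, rfl⟩
  rw [← hM] at hMp hdet ⊢
  have hsq := complete_sq (A := A) (posDef_symm hP) hM (posDef_symm hMp) hMp.det_pos.ne'.isUnit x
  have : ∀ u : Fin n → ℝ, c * Real.exp (-(1 / 2) * ((A.mulVec x + B.mulVec u) ⬝ᵥ
        P.mulVec (A.mulVec x + B.mulVec u))) * gaussDensity 0 S u =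
      (c * (Real.sqrt ((2 * Real.pi) ^ n * S.det))⁻¹ * Real.exp (-(1 / 2) * (x ⬝ᵥ
        (Aᵀ * P * A - Aᵀ * P * B * M⁻¹ * Bᵀ * P * A).mulVec x))) *
      Real.exp (-(1/2) * ((u + (M⁻¹ * Bᵀ * P * A).mulVec x) ⬝ᵥ
        M.mulVec (u + (M⁻¹ * Bᵀ * P * A).mulVec x))) := by
    intro u
    have h := congrArg (fun t => Real.exp (-(1/2) * t)) (hsq u)
    simp only [mul_add, Real.exp_add] at h
    simp only [gaussDensity, sub_zero]
    linear_combination (c * (Real.sqrt ((2 * Real.pi) ^ n * S.det))⁻¹) * h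
  simp_rw [this]
  rw [integral_const_mul, integral_add_right_eq_self
    (fun v : Fin n → ℝ => Real.exp (-(1/2) * (v ⬝ᵥ M.mulVec v))), integral_gauss hMp, hdet,
    Real.sqrt_mul (by positivity), Real.sqrt_mul hS.det_pos.le]
  have h1 : Real.sqrt ((2 * Real.pi) ^ n) ≠ 0 := by positivity
  have h2 : Real.sqrt S.det ≠ 0 := (Real.sqrt_pos.2 hS.det_pos).ne'
  have h3 : Real.sqrt M.det ≠ 0 := (Real.sqrt_pos.2 hMp.det_pos).ne'
  field_simp

/-- The LQG desirability function is given by the solution of the Riccati difference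
equation together with the explicit normalizing product of determinants. -/
theorem stmt_15 {n : ℕ} (N : ℕ) (hN : 0 < N) (A B : Matrix (Fin n) (Fin n) ℝ)
    (Q : ℕ → Matrix (Fin n) (Fin n) ℝ) (hQ : ∀ k ≤ N, (Q k).PosDef)
    (Sg : ℕ → Matrix (Fin n) (Fin n) ℝ) (hSg : ∀ k < N, (Sg k).PosDef)
    (Z : ℕ → (Fin n → ℝ) → ℝ)
    (hZN : ∀ x, Z N x = Real.exp (-(1 / 2) * (x ⬝ᵥ (Q N).mulVec x)))
    (hZk : ∀ k < N, ∀ x, Z k x = Real.exp (-(1 / 2) * (x ⬝ᵥ (Q k).mulVec x)) *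
      ∫ u : Fin n → ℝ, Z (k + 1) (A.mulVec x + B.mulVec u) * gaussDensity 0 (Sg k) u)
    (P : ℕ → Matrix (Fin n) (Fin n) ℝ)
    (hPN : P N = Q N)
    (hPk : ∀ k < N, P k = Q k + Aᵀ * P (k + 1) * A -
      Aᵀ * P (k + 1) * B * ((Sg k)⁻¹ + Bᵀ * P (k + 1) * B)⁻¹ * Bᵀ * P (k + 1) * A) :
    ∀ k ≤ N, (P k).PosDef ∧ ∀ x : Fin n → ℝ,
      Z k x = (∏ s ∈ Finset.Icc (k + 1) N,
          (Real.sqrt ((1 + P s * B * Sg (s - 1) * Bᵀ).det))⁻¹) *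
        Real.exp (-(1 / 2) * (x ⬝ᵥ (P k).mulVec x)) := by
  intro k hk
  induction hk using Nat.decreasingInduction with
  | self =>
    refine ⟨hPN ▸ hQ N le_rfl, fun x => ?_⟩
    rw [hZN, hPN]
    simp
  | of_succ k hk ih =>
    obtain ⟨ih1, ih2⟩ := ih
    have hS := hSg k hk
    refine ⟨?_, fun x => ?_⟩
    · rw [hPk k hk]
      exact step_P ih1 hS (hQ k hk.le)
    · rw [hZk k hk]
      simp_rw [ih2]
      rw [step_int ih1 hS, hPk k hk, add_sub_assoc, add_mulVec, dotProduct_add, mul_add,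
        Real.exp_add, ← Finset.mul_prod_Ioc_eq_prod_Icc (a := k + 1) (by omega : k + 1 ≤ N)]
      have : Finset.Ioc (k + 1) N = Finset.Icc (k + 1 + 1) N := by
        ext i; simp only [Finset.mem_Ioc, Finset.mem_Icc]; omega
      rw [this]
      simp only [Nat.add_sub_cancel]
      ring
end

section
/- Let N be a positive integer, A and B real n×n matrices, Q_k symmetric positive definite n×n matrices for k = 0,…,N, and Σ_k symmetric positive definite n×n matrices for k = 0,…,N−1. Define P_k by the Riccati difference equation P_N = Q_N and P_k = Q_k + AᵀP_{k+1}A − AᵀP_{k+1}B(Σ_k^{−1} + BᵀP_{k+1}B)^{−1}BᵀP_{k+1}A for k = N−1,…,0. Then for every k ∈ {0,…,N−1}, P_k = Q_k + Ā_{N−k}ᵀ (diag(Q_{k+1},…,Q_N)^{−1} + L_{N−k} diag(Σ_k,…,Σ_{N−1}) L_{N−k}ᵀ)^{−1} Ā_{N−k}, where Ā_j := [Aᵀ (A²)ᵀ ⋯ (Aʲ)ᵀ]ᵀ and L_j is the nj×nj block lower-triangular matrix whose (i,ℓ) block, for 1 ≤ ℓ ≤ i ≤ j, is A^{i−ℓ}B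 and whose blocks above the diagonal are zero. (This expresses the equality of the recursive and batch forms of the LQR value function.) -/
open Matrix

/- The `nj × nj` block lower-triangular matrix whose `(i,ℓ)` block, for `ℓ ≤ i`, is
`A^{i−ℓ}B`, and whose blocks above the diagonal are zero. -/
def stackL {n : ℕ} (j : ℕ) (A B : Matrix (Fin n) (Fin n) ℝ) :
    Matrix (Fin j × Fin n) (Fin j × Fin n) ℝ :=
  fun p q => if (q.1 : ℕ) ≤ (p.1 : ℕ) then (A ^ ((p.1 : ℕ) - (q.1 : ℕ)) * B) p.2 q.2 else 0

/- The block diagonal matrix with diagonal blocks `M 0, …, M (j−1)`. -/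
def blockDiagFst {n j : ℕ} (M : Fin j → Matrix (Fin n) (Fin n) ℝ) :
    Matrix (Fin j × Fin n) (Fin j × Fin n) ℝ :=
  fun p q => if p.1 = q.1 then M p.1 p.2 q.2 else 0

/- The `nj × n` stacked matrix `Ā_j = [Aᵀ (A²)ᵀ ⋯ (Aʲ)ᵀ]ᵀ`. -/
def stackA {n : ℕ} (j : ℕ) (A : Matrix (Fin n) (Fin n) ℝ) :
    Matrix (Fin j × Fin n) (Fin n) ℝ :=
  fun p b => (A ^ ((p.1 : ℕ) + 1)) p.2 b

def stepEquiv (j n : ℕ) : Fin n ⊕ (Fin j × Fin n) ≃ Fin (j + 1) × Fin n where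
  toFun := Sum.elim (fun a => (0, a)) (fun p => (p.1.succ, p.2))
  invFun := fun p => Fin.cases (motive := fun _ => Fin n ⊕ (Fin j × Fin n))
    (Sum.inl p.2) (fun i => Sum.inr (i, p.2)) p.1
  left_inv := by
    rintro (a | ⟨i, a⟩) <;> simp
  right_inv := by
    rintro ⟨i, a⟩
    refine Fin.cases ?_ (fun i => ?_) i <;> simp

theorem stackA_step {n : ℕ} (j : ℕ) (A : Matrix (Fin n) (Fin n) ℝ) :
    (stackA (j + 1) A).submatrix (stepEquiv j n) id = fromRows 1 (stackA j A) * A := by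
  rw [fromRows_mul]
  ext (a | ⟨i, a⟩) b
  · simp [stackA, stepEquiv]
  · simp only [submatrix_apply, stackA, stepEquiv, Equiv.coe_fn_mk, Sum.elim_inr, id, Fin.val_succ,
      fromRows_apply_inr]
    rw [pow_succ A (i + 1)]
    rfl

theorem stackL_step {n : ℕ} (j : ℕ) (A B : Matrix (Fin n) (Fin n) ℝ) :
    (stackL (j + 1) A B).submatrix (stepEquiv j n) (stepEquiv j n) =
      fromBlocks B 0 (stackA j A * B) (stackL j A B) := by
  ext (a | ⟨i, a⟩) (b | ⟨l, b⟩)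
  · simp [stackL, stepEquiv]
  · simp [stackL, stepEquiv]
  · simp [stackL, stepEquiv, stackA, Matrix.mul_apply]
  · simp [stackL, stepEquiv]

theorem blockDiagFst_step {n j : ℕ} (M : Fin (j + 1) → Matrix (Fin n) (Fin n) ℝ) :
    (blockDiagFst M).submatrix (stepEquiv j n) (stepEquiv j n) =
      fromBlocks (M 0) 0 0 (blockDiagFst fun i => M i.succ) := by
  ext (a | ⟨i, a⟩) (b | ⟨l, b⟩)
  · simp [blockDiagFst, stepEquiv]
  · simp [blockDiagFst, stepEquiv, (Fin.succ_ne_zero _).symm]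
  · simp [blockDiagFst, stepEquiv]
  · simp [blockDiagFst, stepEquiv]

theorem posDef_fromBlocks_diag {m k : Type*} [Fintype m] [Fintype k]
    {X : Matrix m m ℝ} {Y : Matrix k k ℝ} (hX : X.PosDef) (hY : Y.PosDef) :
    (fromBlocks X 0 0 Y).PosDef := by
  refine PosDef.of_dotProduct_mulVec_pos (hX.1.fromBlocks (by simp) hY.1) fun x hx => ?_
  obtain ⟨u, v, rfl⟩ : ∃ u v, x = Sum.elim u v := ⟨x ∘ Sum.inl, x ∘ Sum.inr, by simp⟩
  have e : star (Sum.elim u v) ⬝ᵥ (fromBlocks X 0 0 Y *ᵥ Sum.elim u v)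
      = star u ⬝ᵥ (X *ᵥ u) + star v ⬝ᵥ (Y *ᵥ v) := by
    simp [fromBlocks_mulVec, dotProduct]
  rw [e]
  by_cases hu : u = 0
  · have hv : v ≠ 0 := by
      rintro rfl
      exact hx (by rw [hu]; ext (a | a) <;> rfl)
    exact add_pos_of_nonneg_of_pos (hX.posSemidef.dotProduct_mulVec_nonneg u)
      (hY.dotProduct_mulVec_pos hv)
  · exact add_pos_of_pos_of_nonneg (hX.dotProduct_mulVec_pos hu)
      (hY.posSemidef.dotProduct_mulVec_nonneg v)

theorem blockDiagFst_posDef {n : ℕ} : ∀ (j : ℕ) (M : Fin j → Matrix (Fin n) (Fin n) ℝ)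
    (_ : ∀ i, (M i).PosDef), (blockDiagFst M).PosDef := by
  intro j
  induction j with
  | zero =>
    intro M _
    refine PosDef.of_dotProduct_mulVec_pos (by ext ⟨i, _⟩; exact i.elim0) fun x hx => ?_
    exact absurd (by ext ⟨i, _⟩; exact i.elim0) hx
  | succ j ih =>
    intro M hM
    have h := posDef_fromBlocks_diag (hM 0) (ih (fun i => M i.succ) fun i => hM _)
    rw [← blockDiagFst_step] at h
    simpa using h.submatrix (stepEquiv j n).symm.injective

theorem batch_step {n : ℕ} (j : ℕ) (A B : Matrix (Fin n) (Fin n) ℝ)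
    (Q S : ℕ → Matrix (Fin n) (Fin n) ℝ) (hQ : ∀ k ≤ j, (Q k).PosDef) :
    ((blockDiagFst fun i : Fin (j + 1) => Q i)⁻¹ +
      stackL (j + 1) A B * blockDiagFst (fun l : Fin (j + 1) => S l) *
        (stackL (j + 1) A B)ᵀ).submatrix (stepEquiv j n) (stepEquiv j n) =
    fromBlocks (Q 0)⁻¹ 0 0 ((blockDiagFst fun i : Fin j => Q (i + 1))⁻¹ +
      stackL j A B * blockDiagFst (fun l : Fin j => S (l + 1)) * (stackL j A B)ᵀ) +
    (fromRows 1 (stackA j A) * B) * S 0 * (fromRows 1 (stackA j A) * B)ᵀ := by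
  have hbd : (blockDiagFst fun i : Fin j => Q (i + 1)).PosDef :=
    blockDiagFst_posDef j _ fun i => hQ _ i.2
  have h1 : (blockDiagFst fun i : Fin (j + 1) => Q i)⁻¹.submatrix (stepEquiv j n) (stepEquiv j n)
      = fromBlocks (Q 0)⁻¹ 0 0 (blockDiagFst fun i : Fin j => Q (i + 1))⁻¹ := by
    rw [← inv_submatrix_equiv, blockDiagFst_step]
    simp only [Fin.val_zero, Fin.val_succ]
    rw [inv_fromBlocks_zero₁₂_of_isUnit_iff _ _ _
      (iff_of_true (hQ 0 (Nat.zero_le _)).isUnit hbd.isUnit)]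
    simp
  have h2 : (stackL (j + 1) A B * blockDiagFst (fun l : Fin (j + 1) => S l) *
        (stackL (j + 1) A B)ᵀ).submatrix (stepEquiv j n) (stepEquiv j n) =
      fromBlocks B 0 (stackA j A * B) (stackL j A B) *
        fromBlocks (S 0) 0 0 (blockDiagFst fun l : Fin j => S (l + 1)) *
        (fromBlocks B 0 (stackA j A * B) (stackL j A B))ᵀ := by
    rw [← stackL_step, transpose_submatrix]
    have := blockDiagFst_step fun l : Fin (j + 1) => S l
    simp only [Fin.val_zero, Fin.val_succ] at this
    rw [← this, submatrix_mul_equiv, submatrix_mul_equiv]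
  rw [submatrix_add, Pi.add_apply, Pi.add_apply, h1, h2, fromRows_mul, Matrix.one_mul,
    fromRows_mul, transpose_fromRows, fromRows_mul_fromCols, fromBlocks_transpose,
    fromBlocks_multiply, fromBlocks_multiply, fromBlocks_add, fromBlocks_add]
  simp
  abel

theorem batch_main {n : ℕ} (A B : Matrix (Fin n) (Fin n) ℝ) : ∀ (j : ℕ)
    (Q S P : ℕ → Matrix (Fin n) (Fin n) ℝ) (_ : ∀ k ≤ j, (Q k).PosDef)
    (_ : ∀ k < j, (S k).PosDef) (_ : P j = Q j)
    (_ : ∀ k < j, P k = Q k + Aᵀ * P (k + 1) * A -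
      Aᵀ * P (k + 1) * B * ((S k)⁻¹ + Bᵀ * P (k + 1) * B)⁻¹ * Bᵀ * P (k + 1) * A),
    P 0 = Q 0 + (stackA j A)ᵀ *
        ((blockDiagFst fun i : Fin j => Q (i + 1))⁻¹ +
          stackL j A B * blockDiagFst (fun l : Fin j => S l) *
            (stackL j A B)ᵀ)⁻¹ * stackA j A := by
  intro j
  induction j with
  | zero =>
    intro Q S P _ _ hP _
    rw [hP]
    ext a b
    simp [Matrix.mul_apply]
  | succ j ih =>
    intro Q S P hQ hS hP hR
    have IH := ih (fun k => Q (k + 1)) (fun k => S (k + 1)) (fun k => P (k + 1))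
      (fun k hk => hQ _ (by omega)) (fun k hk => hS _ (by omega)) hP
      (fun k hk => hR _ (by omega))
    have hst := batch_step j A B (fun k => Q (k + 1)) S (fun k hk => hQ _ (by omega))
    have h0 := hR 0 (by omega)
    have hbd : (blockDiagFst fun i : Fin j => Q (i + 1 + 1)).PosDef :=
      blockDiagFst_posDef j _ fun i => hQ _ (by omega)
    have hbs : (blockDiagFst fun i : Fin j => S (i + 1)).PosDef :=
      blockDiagFst_posDef j _ fun i => hS _ (by omega)
    simp only [zero_add] at IH hst h0
    have hM : ((blockDiagFst fun i : Fin j => Q (i + 1 + 1))⁻¹ +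
      stackL j A B * blockDiagFst (fun l : Fin j => S (l + 1)) * (stackL j A B)ᵀ).PosDef := by
      refine hbd.inv.add_posSemidef ?_
      simpa using hbs.posSemidef.mul_mul_conjTranspose_same (stackL j A B)
    set M := (blockDiagFst fun i : Fin j => Q (i + 1 + 1))⁻¹ +
      stackL j A B * blockDiagFst (fun l : Fin j => S (l + 1)) * (stackL j A B)ᵀ with hMdef
    have hQ1 := hQ 1 (by omega)
    have hS0 := hS 0 (by omega)
    have hP1 : (P 1).PosSemidef := by
      rw [IH]
      refine hQ1.posSemidef.add ?_
      simpa using hM.inv.posSemidef.conjTranspose_mul_mul_same (stackA j A)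
    have hW : (fromBlocks (Q 1)⁻¹ 0 0 M).PosDef := posDef_fromBlocks_diag hQ1.inv hM
    have hWi : (fromBlocks (Q 1)⁻¹ 0 0 M)⁻¹ = fromBlocks (Q 1) 0 0 M⁻¹ := by
      rw [inv_fromBlocks_zero₁₂_of_isUnit_iff _ _ _
        (iff_of_true hQ1.inv.isUnit hM.isUnit),
        nonsing_inv_nonsing_inv _ ((isUnit_iff_isUnit_det _).1 hQ1.isUnit)]
      simp
    have hO : (fromRows (1 : Matrix (Fin n) (Fin n) ℝ) (stackA j A))ᵀ * (fromBlocks (Q 1)⁻¹ 0 0 M)⁻¹ *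
        fromRows (1 : Matrix (Fin n) (Fin n) ℝ) (stackA j A) = P 1 := by
      rw [hWi, IH, transpose_fromRows, fromCols_mul_fromBlocks, fromCols_mul_fromRows]
      simp
    set W := fromBlocks (Q 1)⁻¹ 0 0 M with hWdef
    set O : Matrix (Fin n ⊕ (Fin j × Fin n)) (Fin n) ℝ := fromRows 1 (stackA j A) with hOdef
    have hK : (O * B)ᵀ * W⁻¹ * (O * B) = Bᵀ * P 1 * B := by
      rw [← hO, transpose_mul]
      simp only [Matrix.mul_assoc]
    have hKu : IsUnit ((S 0)⁻¹ + (O * B)ᵀ * W⁻¹ * (O * B)) := by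
      rw [hK]
      refine (hS0.inv.add_posSemidef ?_).isUnit
      simpa using hP1.conjTranspose_mul_mul_same B
    have hwood := add_mul_mul_inv_eq_sub W (O * B) (S 0) (O * B)ᵀ hW.isUnit hS0.isUnit hKu
    rw [hK] at hwood
    set Z := (blockDiagFst fun i : Fin (j + 1) => Q (i + 1))⁻¹ +
      stackL (j + 1) A B * blockDiagFst (fun l : Fin (j + 1) => S l) *
        (stackL (j + 1) A B)ᵀ with hZ
    have hre : (stackA (j + 1) A)ᵀ * Z⁻¹ * stackA (j + 1) A =
        (O * A)ᵀ * (W + O * B * S 0 * (O * B)ᵀ)⁻¹ * (O * A) := by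
      rw [← hst, inv_submatrix_equiv, hOdef, ← stackA_step, transpose_submatrix,
        submatrix_mul_equiv, submatrix_mul_equiv, submatrix_id_id]
    rw [hre, hwood, h0, add_sub_assoc]
    congr 1
    generalize ((S 0)⁻¹ + Bᵀ * P 1 * B)⁻¹ = K
    rw [← hO]
    simp only [transpose_mul, Matrix.mul_sub, Matrix.sub_mul, Matrix.mul_assoc]

/-- Equality of the recursive (Riccati) and batch forms of the LQR value function. -/
theorem stmt_18 {n : ℕ} (N : ℕ) (hN : 0 < N) (A B : Matrix (Fin n) (Fin n) ℝ)
    (Q : ℕ → Matrix (Fin n) (Fin n) ℝ) (hQ : ∀ k ≤ N, (Q k).PosDef)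
    (Sg : ℕ → Matrix (Fin n) (Fin n) ℝ) (hSg : ∀ k < N, (Sg k).PosDef)
    (P : ℕ → Matrix (Fin n) (Fin n) ℝ)
    (hPN : P N = Q N)
    (hPk : ∀ k < N, P k = Q k + Aᵀ * P (k + 1) * A -
      Aᵀ * P (k + 1) * B * ((Sg k)⁻¹ + Bᵀ * P (k + 1) * B)⁻¹ * Bᵀ * P (k + 1) * A) :
    ∀ k < N,
      P k = Q k + (stackA (N - k) A)ᵀ *
        ((blockDiagFst fun i : Fin (N - k) => Q (k + 1 + i))⁻¹ +
          stackL (N - k) A B * blockDiagFst (fun l : Fin (N - k) => Sg (k + l)) *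
            (stackL (N - k) A B)ᵀ)⁻¹ * stackA (N - k) A := by
  intro k hk
  have h := batch_main A B (N - k) (fun i => Q (k + i)) (fun i => Sg (k + i)) (fun i => P (k + i))
    (fun i hi => hQ _ (by omega)) (fun i hi => hSg _ (by omega))
    (by simpa [Nat.add_sub_cancel' hk.le] using hPN) (fun i hi => hPk _ (by omega))
  have e : (fun i : Fin (N - k) => Q (k + 1 + i)) = fun i : Fin (N - k) => Q (k + (i + 1)) := by
    funext i
    congr 1
    omega
  rw [e]
  exact h
end

section
/- Let N be a positive integer, A and B real n×n matrices, Q_k symmetric positive definite n×n matrices for k = 0,…,N, and Σ_k symmetric positive definite n×n matrices for k = 0,…,N−1. Define P_k by the Riccati difference equation P_N = Q_N and P_k = Q_k + AᵀP_{k+1}A − AᵀP_{k+1}B(Σ_k^{−1} + BᵀP_{k+1}B)^{−1}BᵀP_{k+1}A. Then for every k ∈ {0,…,N−1}, ∏_{s=k+1}^{N} det(I + P_s B Σ_{s−1} Bᵀ) = det(I + diag(Q_{k+1},…,Q_N) · L_{N−k} diag(Σ_k,…,Σ_{N−1}) L_{N−k}ᵀ), where L_j is the nj×nj block lower-triangular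 matrix whose (i,ℓ) block, for 1 ≤ ℓ ≤ i ≤ j, is A^{i−ℓ}B and whose blocks above the diagonal are zero. (This expresses the equality of the normalizing constants in the backward-recursive and path-integral forms of the LQG desirability function.) -/
open Matrix

lemma ric_psd {n : ℕ} (A B q g : Matrix (Fin n) (Fin n) ℝ) (hq : q.PosSemidef) (hg : g.PosDef) :
    (g⁻¹ + Bᵀ * q * B).PosDef ∧
    (Aᵀ * q * A - Aᵀ * q * B * (g⁻¹ + Bᵀ * q * B)⁻¹ * Bᵀ * q * A).PosSemidef := by
  have h1 : (Bᵀ * q * B).PosSemidef := by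
    simpa using hq.conjTranspose_mul_mul_same B
  have h2 : (g⁻¹ + Bᵀ * q * B).PosDef := hg.inv.add_posSemidef h1
  refine ⟨h2, ?_⟩
  have hqt : qᵀ = q := by simpa using hq.1.eq
  have : Invertible (g⁻¹ + Bᵀ * q * B) := h2.isUnit.invertible
  have h3 := (Matrix.PosDef.fromBlocks₂₂ (Aᵀ * q * A) (Aᵀ * q * B) h2)
  have e : (Aᵀ * q * B)ᴴ = Bᵀ * q * A := by
    simp [Matrix.transpose_mul, hqt, Matrix.mul_assoc]
  rw [e] at h3
  have h4 : (fromBlocks (Aᵀ * q * A) (Aᵀ * q * B) (Bᵀ * q * A) (g⁻¹ + Bᵀ * q * B)).PosSemidef := by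
    have h5 := hq.conjTranspose_mul_mul_same (fromCols A B)
    have h6 : (fromBlocks (0 : Matrix (Fin n) (Fin n) ℝ) 0 0 g⁻¹).PosSemidef := by
      have := hg.inv.posSemidef.conjTranspose_mul_mul_same
        (fromCols (0 : Matrix (Fin n) (Fin n) ℝ) (1 : Matrix (Fin n) (Fin n) ℝ))
      rw [conjTranspose_fromCols_eq_fromRows_conjTranspose, fromRows_mul,
        fromRows_mul_fromCols] at this
      simpa using this
    have h7 := h6.add h5
    convert h7 using 1
    rw [conjTranspose_fromCols_eq_fromRows_conjTranspose, fromRows_mul, fromRows_mul_fromCols,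
      fromBlocks_add]
    simp
  have h8 := h3.1 h4
  simpa [Matrix.mul_assoc] using h8

lemma abs_det {n : ℕ} {m : Type*} [Fintype m] [DecidableEq m] (S L Q : Matrix m m ℝ)
    (E : Matrix (Fin n) m ℝ) (A B q g : Matrix (Fin n) (Fin n) ℝ)
    (hq : q.PosSemidef) (hg : g.PosDef) :
    (1 + fromBlocks Q 0 0 q * (fromBlocks L 0 (A * E * L) B * fromBlocks S 0 0 g *
      (fromBlocks L 0 (A * E * L) B)ᵀ)).det =
    (1 + q * B * g * Bᵀ).det * (1 + (Q + Eᵀ *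
      (Aᵀ * q * A - Aᵀ * q * B * (g⁻¹ + Bᵀ * q * B)⁻¹ * Bᵀ * q * A) * E) * (L * S * Lᵀ)).det := by
  obtain ⟨h2, -⟩ := ric_psd A B q g hq hg
  have hgu : IsUnit g.det := (Matrix.isUnit_iff_isUnit_det _).1 hg.isUnit
  have hD : 1 + g * (Bᵀ * q * B) = g * (g⁻¹ + Bᵀ * q * B) := by
    rw [Matrix.mul_add, Matrix.mul_nonsing_inv _ hgu]
  have hDu : IsUnit (1 + g * (Bᵀ * q * B)) := by
    rw [hD]; exact hg.isUnit.mul h2.isUnit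
  have hDi : (1 + g * (Bᵀ * q * B))⁻¹ * g = (g⁻¹ + Bᵀ * q * B)⁻¹ := by
    rw [hD, Matrix.mul_inv_rev, Matrix.mul_assoc, Matrix.nonsing_inv_mul _ hgu, Matrix.mul_one]
  have := hDu.invertible
  have r1 : (1 + q * B * g * Bᵀ).det = (1 + g * (Bᵀ * q * B)).det := by
    rw [show q * B * g * Bᵀ = (q * B) * (g * Bᵀ) by simp only [Matrix.mul_assoc],
      det_one_add_mul_comm]
    simp only [Matrix.mul_assoc]
  have r2 : ∀ X : Matrix m m ℝ, (1 + X * (L * S * Lᵀ)).det = (1 + S * (Lᵀ * X * L)).det := by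
    intro X
    rw [show X * (L * S * Lᵀ) = (X * L) * (S * Lᵀ) by simp only [Matrix.mul_assoc],
      det_one_add_mul_comm]
    simp only [Matrix.mul_assoc]
  rw [r1, r2, ← hDi, ← Matrix.mul_assoc (fromBlocks Q 0 0 q), det_one_add_mul_comm]
  have key : (fromBlocks L 0 (A * E * L) B)ᵀ * (fromBlocks Q 0 0 q *
      (fromBlocks L 0 (A * E * L) B * fromBlocks S 0 0 g)) =
      (fromBlocks (Lᵀ * Q * L + Lᵀ * Eᵀ * Aᵀ * q * A * E * L) (Lᵀ * Eᵀ * Aᵀ * q * B)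
        (Bᵀ * q * A * E * L) (Bᵀ * q * B)) * fromBlocks S 0 0 g := by
    simp [fromBlocks_transpose, fromBlocks_multiply, Matrix.mul_assoc, Matrix.add_mul]
  rw [key, det_one_add_mul_comm, fromBlocks_multiply, ← fromBlocks_one, fromBlocks_add]
  simp only [Matrix.zero_mul, add_zero, zero_add]
  rw [det_fromBlocks₂₂, invOf_eq_nonsing_inv]
  congr 2
  simp only [Matrix.mul_add, Matrix.add_mul, Matrix.mul_sub, Matrix.sub_mul, Matrix.mul_assoc]
  abel

noncomputable def splitLast (j n : ℕ) : (Fin j × Fin n) ⊕ Fin n ≃ Fin (j + 1) × Fin n :=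
  Equiv.ofBijective (Sum.elim (fun p => (p.1.castSucc, p.2)) (fun b => (Fin.last j, b))) (by
    constructor
    · rintro (⟨a, b⟩ | b) (⟨c, d⟩ | d) h
      · simpa using h
      · have := congrArg (fun x => (x.1 : ℕ)) h
        have h2 := a.2
        simp at this
        omega
      · have := congrArg (fun x => (x.1 : ℕ)) h
        have h2 := c.2
        simp at this
        omega
      · simpa using h
    · rintro ⟨a, b⟩
      induction a using Fin.lastCases with
      | last => exact ⟨Sum.inr b, rfl⟩
      | cast i => exact ⟨Sum.inl (i, b), rfl⟩)

@[simp] lemma splitLast_inl (j n : ℕ) (p : Fin j × Fin n) :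
    splitLast j n (Sum.inl p) = (p.1.castSucc, p.2) := rfl

@[simp] lemma splitLast_inr (j n : ℕ) (p : Fin n) :
    splitLast j n (Sum.inr p) = (Fin.last j, p) := rfl

noncomputable def pickLast (j n : ℕ) : Matrix (Fin n) (Fin j × Fin n) ℝ :=
  fun a p => if (p.1 : ℕ) + 1 = j ∧ a = p.2 then 1 else 0

lemma blockDiag_split {n j : ℕ} (M : Fin (j + 1) → Matrix (Fin n) (Fin n) ℝ) :
    (blockDiagFst M).submatrix (splitLast j n) (splitLast j n) =
      fromBlocks (blockDiagFst fun i : Fin j => M i.castSucc) 0 0 (M (Fin.last j)) := by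
  ext (⟨a, b⟩ | b) (⟨c, d⟩ | d)
  · simp [blockDiagFst]
  · simp [blockDiagFst, Fin.castSucc_ne_last]
  · simp [blockDiagFst, (Fin.castSucc_ne_last _).symm]
  · simp [blockDiagFst]

lemma pick_mul {n j : ℕ} (X : Matrix (Fin (j + 1) × Fin n) (Fin (j + 1) × Fin n) ℝ) (a : Fin n)
    (p : Fin (j + 1) × Fin n) : (pickLast (j + 1) n * X) a p = X (Fin.last j, a) p := by
  rw [Matrix.mul_apply, Finset.sum_eq_single (Fin.last j, a)]
  · simp [pickLast]
  · rintro ⟨c, d⟩ - h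
    rw [pickLast, if_neg, zero_mul]
    rintro ⟨h1, h2⟩
    apply h
    ext
    · simpa using h1
    · simp [h2]
  · simp

lemma stack_split {n : ℕ} (j : ℕ) (A B : Matrix (Fin n) (Fin n) ℝ) :
    (stackL (j + 1) A B).submatrix (splitLast j n) (splitLast j n) =
      fromBlocks (stackL j A B) 0 (A * pickLast j n * stackL j A B) B := by
  ext (⟨a, b⟩ | b) (⟨c, d⟩ | d)
  · simp [stackL]
  · have := a.2
    simp [stackL]
  · cases j with
    | zero => exact c.elim0
    | succ j =>
      have h : ∀ x, (pickLast (j + 1) n * stackL (j + 1) A B) x (c, d) = (A ^ (j - c) * B) x d := by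
        intro x
        rw [pick_mul]
        have := c.2
        simp [stackL, Nat.lt_succ_iff.1 this]
      have hc := c.2
      rw [fromBlocks_apply₂₁, Matrix.mul_assoc, Matrix.mul_apply]
      simp only [h]
      rw [← Matrix.mul_apply, ← Matrix.mul_assoc, ← pow_succ']
      have e : j + 1 - (c : ℕ) = j - c + 1 := by omega
      simp [stackL, hc.le, e]
  · simp [stackL]

lemma blockDiag_add_last {n j : ℕ} (M : Fin j → Matrix (Fin n) (Fin n) ℝ)
    (X : Matrix (Fin n) (Fin n) ℝ) :
    blockDiagFst M + (pickLast j n)ᵀ * X * pickLast j n =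
      blockDiagFst fun i : Fin j => M i + if (i : ℕ) + 1 = j then X else 0 := by
  ext ⟨a, b⟩ ⟨c, d⟩
  have h : ((pickLast j n)ᵀ * X * pickLast j n) (a, b) (c, d) =
      if (a : ℕ) + 1 = j ∧ (c : ℕ) + 1 = j then X b d else 0 := by
    by_cases h1 : (a : ℕ) + 1 = j <;> by_cases h2 : (c : ℕ) + 1 = j <;>
      simp [Matrix.mul_apply, pickLast, h1, h2]
  rw [Matrix.add_apply, h]
  by_cases hac : a = c
  · subst hac
    by_cases h1 : (a : ℕ) + 1 = j <;> simp [blockDiagFst, h1]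
  · have : ¬ ((a : ℕ) + 1 = j ∧ (c : ℕ) + 1 = j) := by
      rintro ⟨h1, h2⟩
      apply hac
      ext
      omega
    simp [blockDiagFst, hac, this]

lemma step_det {n j : ℕ} (A B : Matrix (Fin n) (Fin n) ℝ)
    (Q S : Fin (j + 1) → Matrix (Fin n) (Fin n) ℝ) (q g : Matrix (Fin n) (Fin n) ℝ)
    (hQ : Q (Fin.last j) = q) (hS : S (Fin.last j) = g)
    (hq : q.PosSemidef) (hg : g.PosDef) :
    (1 + blockDiagFst Q * (stackL (j + 1) A B * blockDiagFst S * (stackL (j + 1) A B)ᵀ)).det =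
    (1 + q * B * g * Bᵀ).det *
    (1 + blockDiagFst (fun i : Fin j => Q i.castSucc + if (i : ℕ) + 1 = j then
      (Aᵀ * q * A - Aᵀ * q * B * (g⁻¹ + Bᵀ * q * B)⁻¹ * Bᵀ * q * A) else 0) *
      (stackL j A B * blockDiagFst (fun i : Fin j => S i.castSucc) * (stackL j A B)ᵀ)).det := by
  rw [← det_submatrix_equiv_self (splitLast j n), ← blockDiag_add_last, ← abs_det _ _ _ _ _ _ _ _ hq hg,
    submatrix_add, Pi.add_apply, Pi.add_apply, submatrix_one_equiv]
  simp only [← submatrix_mul_equiv _ _ _ (splitLast j n) _, ← transpose_submatrix, blockDiag_split,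
    stack_split, hQ, hS]

/-- Equality of the normalizing constants in the backward-recursive and path-integral
forms of the LQG desirability function. -/
theorem stmt_19 {n : ℕ} (N : ℕ) (hN : 0 < N) (A B : Matrix (Fin n) (Fin n) ℝ)
    (Q : ℕ → Matrix (Fin n) (Fin n) ℝ) (hQ : ∀ k ≤ N, (Q k).PosDef)
    (Sg : ℕ → Matrix (Fin n) (Fin n) ℝ) (hSg : ∀ k < N, (Sg k).PosDef)
    (P : ℕ → Matrix (Fin n) (Fin n) ℝ)
    (hPN : P N = Q N)
    (hPk : ∀ k < N, P k = Q k + Aᵀ * P (k + 1) * A -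
      Aᵀ * P (k + 1) * B * ((Sg k)⁻¹ + Bᵀ * P (k + 1) * B)⁻¹ * Bᵀ * P (k + 1) * A) :
    ∀ k < N,
      ∏ s ∈ Finset.Icc (k + 1) N, (1 + P s * B * Sg (s - 1) * Bᵀ).det =
        (1 + blockDiagFst (fun i : Fin (N - k) => Q (k + 1 + i)) *
          (stackL (N - k) A B * blockDiagFst (fun l : Fin (N - k) => Sg (k + l)) *
            (stackL (N - k) A B)ᵀ)).det := by
  intro k hk
  have hP : ∀ d ≤ N, (P (N - d)).PosSemidef := by
    intro d
    induction d with
    | zero => intro _; simpa [hPN] using (hQ N le_rfl).posSemidef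
    | succ d ih =>
      intro hd
      have h1 := ih (by omega)
      have e : N - d = N - (d + 1) + 1 := by omega
      rw [e] at h1
      have h2 := ric_psd A B _ _ h1 (hSg (N - (d + 1)) (by omega))
      rw [hPk _ (by omega), add_sub_assoc]
      exact (hQ _ (by omega)).posSemidef.add h2.2
  have hP' : ∀ s ≤ N, (P s).PosSemidef := by
    intro s hs
    have := hP (N - s) (by omega)
    rwa [show N - (N - s) = s by omega] at this
  have main : ∀ j, k + j ≤ N → ∏ s ∈ Finset.Icc (k + 1) (k + j), (1 + P s * B * Sg (s - 1) * Bᵀ).det =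
      (1 + blockDiagFst (fun i : Fin j => if (i : ℕ) + 1 = j then P (k + 1 + i) else Q (k + 1 + i)) *
          (stackL j A B * blockDiagFst (fun l : Fin j => Sg (k + l)) *
            (stackL j A B)ᵀ)).det := by
    intro j
    induction j with
    | zero => intro _; simp
    | succ j ih =>
      intro hj
      rw [← add_assoc, Finset.prod_Icc_succ_top (by omega), ih (by omega), mul_comm]
      rw [step_det A B _ _ (P (k + j + 1)) (Sg (k + j)) (by simp [add_right_comm]) (by simp)
        (hP' _ (by omega)) (hSg _ (by omega))]
      simp only [Nat.add_sub_cancel]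
      congr 5
      funext i
      have hi := i.2
      by_cases h : (i : ℕ) + 1 = j
      · have e : k + 1 + (i : ℕ) = k + j := by omega
        simp only [h, if_true, Fin.val_castSucc, e]
        rw [if_neg (by omega), hPk _ (by omega), add_sub_assoc]
      · simp only [h, if_false, Fin.val_castSucc, add_zero]
        rw [if_neg (by omega)]
  have h := main (N - k) (by omega)
  rw [show k + (N - k) = N by omega] at h
  rw [h]
  congr 4
  funext i
  have hi := i.2
  split_ifs with hh
  · rw [show k + 1 + (i : ℕ) = N by omega, hPN]
  · rfl
end
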